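/- For every integer k ≥ 1 and every real x > 0, the function h(x) = e^{1/x} − ψ'(x) satisfies (−1)^k h^{(k)}(x) = ∫_0^∞ [∑_{m=0}^∞ u^m/(m!·(m+1)!) − u/(1 − e^{−u})] u^k e^{−xu} du. -/

import Mathlib

open MeasureTheory

/-- The trigamma function `ψ'(t) = ∑_{n=0}^∞ 1/(t+n)²`. -/
noncomputable def trigamma (t : ℝ) : ℝ := ∑' n : ℕ, 1 / (t + n) ^ 2

open Filter Topology ProbabilityTheory

/-- Differentiation under the integral sign for the Laplace transform of a nonnegative function. -/
lemma laplaceTransform_analyticAt_and_iteratedDeriv {φ : ℝ → ℝ} (hφ : ∀ u, 0 < u → 0 ≤ φ u)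
    (hint : ∀ t : ℝ, 0 < t → IntegrableOn (fun u => φ u * Real.exp (-t * u)) (Set.Ioi 0))
    (k : ℕ) {x : ℝ} (hx : 0 < x) :
    AnalyticAt ℝ (fun t : ℝ => ∫ u in Set.Ioi (0 : ℝ), φ u * Real.exp (-t * u)) x ∧
    IntegrableOn (fun u => φ u * u ^ k * Real.exp (-x * u)) (Set.Ioi 0) ∧
    iteratedDeriv k (fun t : ℝ => ∫ u in Set.Ioi (0 : ℝ), φ u * Real.exp (-t * u)) x =
      (-1) ^ k * ∫ u in Set.Ioi (0 : ℝ), φ u * u ^ k * Real.exp (-x * u) := by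
  set ν : Measure ℝ := volume.restrict (Set.Ioi 0)
  have hmeas : AEMeasurable (fun u => (φ u).toNNReal) ν := by
    have h : AEMeasurable (fun u => φ u * Real.exp (-1 * u) * Real.exp u) ν :=
      (hint 1 one_pos).1.aemeasurable.mul (by fun_prop)
    refine (h.congr (Eventually.of_forall fun u => ?_)).real_toNNReal
    simp [mul_assoc, ← Real.exp_add]
  set μ : Measure ℝ := ν.withDensity fun u => ((φ u).toNNReal : ENNReal)
  have hcongr (g : ℝ → ℝ) : (fun u => (φ u).toNNReal • g u) =ᵐ[ν] fun u => φ u * g u := by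
    filter_upwards [ae_restrict_mem measurableSet_Ioi] with u hu
    rw [NNReal.smul_def, Real.coe_toNNReal _ (hφ u hu), smul_eq_mul]
  have hintegrable (g : ℝ → ℝ) : Integrable g μ ↔ Integrable (fun u => φ u * g u) ν := by
    rw [integrable_withDensity_iff_integrable_smul₀ hmeas, integrable_congr (hcongr g)]
  have hintegral (g : ℝ → ℝ) : ∫ u, g u ∂μ = ∫ u, φ u * g u ∂ν := by
    rw [integral_withDensity_eq_integral_smul₀ hmeas, integral_congr_ae (hcongr g)]
  have hmgf : (fun t : ℝ => ∫ u, φ u * Real.exp (-t * u) ∂ν) = mgf (fun u => -u) μ := by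
    ext t
    rw [mgf, hintegral]
    simp
  have hmem : x ∈ interior (integrableExpSet (fun u : ℝ => -u) μ) := by
    refine mem_interior.2 ⟨Set.Ioi 0, fun t ht => ?_, isOpen_Ioi, hx⟩
    rw [integrableExpSet, Set.mem_ofPred_eq, hintegrable]
    simpa [IntegrableOn] using hint t ht
  have hpow (u : ℝ) : φ u * ((-u) ^ k * Real.exp (x * -u)) =
      (-1) ^ k * (φ u * u ^ k * Real.exp (-x * u)) := by
    rw [neg_pow, mul_neg, neg_mul]
    ring
  refine ⟨hmgf ▸ analyticAt_mgf hmem, ?_, ?_⟩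
  · have h := integrable_pow_mul_exp_of_mem_interior_integrableExpSet hmem k
    rw [hintegrable] at h
    simp_rw [hpow] at h
    exact (integrable_const_mul_iff (by simp) _).1 h
  · rw [hmgf, iteratedDeriv_mgf hmem, hintegral]
    simp_rw [hpow]
    exact integral_const_mul _ _

lemma integral_pow_mul_exp_neg_mul_Ioi (n : ℕ) {r : ℝ} (hr : 0 < r) :
    ∫ u in Set.Ioi (0 : ℝ), u ^ n * Real.exp (-r * u) = n.factorial / r ^ (n + 1) := by
  have h := Real.integral_rpow_mul_exp_neg_mul_Ioi (a := (n : ℝ) + 1) (by positivity) hr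
  rw [Real.Gamma_nat_eq_factorial] at h
  simp only [add_sub_cancel_right, Real.rpow_natCast, ← neg_mul] at h
  rw [h, ← Nat.cast_succ, Real.rpow_natCast]
  simp [div_eq_mul_inv, mul_comm]

lemma integrableOn_pow_mul_exp_neg_mul_Ioi (n : ℕ) {r : ℝ} (hr : 0 < r) :
    IntegrableOn (fun u : ℝ => u ^ n * Real.exp (-r * u)) (Set.Ioi 0) := by
  refine Integrable.of_integral_ne_zero ?_
  rw [integral_pow_mul_exp_neg_mul_Ioi n hr]
  positivity

/-- Termwise integration of a series of nonnegative functions. -/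
lemma hasSum_setIntegral_Ioi_of_nonneg {F : ℕ → ℝ → ℝ} {a : ℕ → ℝ} {s : ℝ}
    (hF : ∀ n, ∀ u, 0 < u → 0 ≤ F n u) (hint : ∀ n, IntegrableOn (F n) (Set.Ioi 0))
    (ha : ∀ n, ∫ u in Set.Ioi (0 : ℝ), F n u = a n) (hs : HasSum a s) :
    ∫ u in Set.Ioi (0 : ℝ), ∑' n, F n u = s := by
  have h := hasSum_integral_of_summable_integral_norm hint (by
    refine hs.summable.congr fun n => ?_
    rw [← ha n]
    refine setIntegral_congr_fun measurableSet_Ioi fun u hu => ?_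
    exact (Real.norm_of_nonneg (hF n u hu)).symm)
  simp_rw [ha] at h
  exact h.unique hs

lemma integral_bessel_mul_exp {t : ℝ} (ht : 0 < t) :
    ∫ u in Set.Ioi (0 : ℝ), (∑' m : ℕ, u ^ m / (m.factorial * (m + 1).factorial)) *
      Real.exp (-t * u) = Real.exp (1 / t) - 1 := by
  simp_rw [← tsum_mul_right]
  have hterm (m : ℕ) (u : ℝ) :
      u ^ m / (m.factorial * (m + 1).factorial) * Real.exp (-t * u) =
        (1 / (m.factorial * (m + 1).factorial : ℝ)) * (u ^ m * Real.exp (-t * u)) := by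
    ring
  refine hasSum_setIntegral_Ioi_of_nonneg (a := fun m => (1 / t) ^ (m + 1) / (m + 1).factorial)
    (fun n u hu => by positivity) (fun m => ?_) (fun m => ?_) ?_
  · simp_rw [hterm]
    exact (integrableOn_pow_mul_exp_neg_mul_Ioi m ht).const_mul _
  · simp_rw [hterm]
    rw [integral_const_mul, integral_pow_mul_exp_neg_mul_Ioi m ht, one_div_pow]
    have := m.factorial_ne_zero
    field_simp
  · have h := NormedSpace.expSeries_div_hasSum_exp (1 / t : ℝ)
    rw [← Real.exp_eq_exp_ℝ, ← hasSum_nat_add_iff' 1] at h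
    simpa using h

lemma summable_one_div_add_nat_sq (t : ℝ) : Summable fun n : ℕ => 1 / (t + n) ^ 2 := by
  refine ((Real.summable_one_div_nat_add_rpow t 2).2 one_lt_two).congr fun n => ?_
  rw [Real.rpow_two, sq_abs, add_comm]

lemma integral_div_one_sub_exp_mul_exp {t : ℝ} (ht : 0 < t) :
    ∫ u in Set.Ioi (0 : ℝ), u / (1 - Real.exp (-u)) * Real.exp (-t * u) = trigamma t := by
  have hpos (n : ℕ) : 0 < t + n := by positivity
  rw [← hasSum_setIntegral_Ioi_of_nonneg (F := fun n u => u ^ 1 * Real.exp (-(t + n) * u))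
    (fun n u hu => by positivity) (fun n => integrableOn_pow_mul_exp_neg_mul_Ioi 1 (hpos n))
    (fun n => by simpa using integral_pow_mul_exp_neg_mul_Ioi 1 (hpos n))
    (by simpa [trigamma] using (summable_one_div_add_nat_sq t).hasSum : HasSum _ (trigamma t))]
  refine setIntegral_congr_fun measurableSet_Ioi fun u (hu : 0 < u) => ?_
  have hterm (n : ℕ) : u ^ 1 * Real.exp (-(t + n) * u) =
      u * Real.exp (-t * u) * Real.exp (-u) ^ n := by
    rw [← Real.exp_nat_mul, mul_assoc, ← Real.exp_add]
    ring_nf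
  simp_rw [hterm]
  rw [tsum_mul_left, tsum_geometric_of_lt_one (Real.exp_pos _).le (by simpa using hu)]
  ring

lemma trigamma_pos {t : ℝ} (ht : 0 < t) : 0 < trigamma t :=
  (summable_one_div_add_nat_sq t).tsum_pos (fun n => by positivity) 0 (by positivity)

/-- For every integer `k ≥ 1` and every `x > 0`, the function
`h(x) = e^{1/x} − ψ'(x)` satisfies
`(−1)^k h^{(k)}(x) = ∫_0^∞ [∑_{m=0}^∞ u^m/(m!·(m+1)!) − u/(1 − e^{−u})] u^k e^{−xu} du`. -/
theorem iteratedDeriv_exp_sub_trigamma_integral_repr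
    (k : ℕ) (hk : 1 ≤ k) (x : ℝ) (hx : 0 < x) :
    (-1) ^ k *
        iteratedDeriv k (fun t : ℝ => Real.exp (1 / t) - trigamma t) x =
      ∫ u in Set.Ioi (0 : ℝ),
        ((∑' m : ℕ, u ^ m / (m.factorial * (m + 1).factorial)) -
            u / (1 - Real.exp (-u))) *
          u ^ k * Real.exp (-x * u) := by
  have hB := laplaceTransform_analyticAt_and_iteratedDeriv
    (φ := fun u : ℝ => ∑' m : ℕ, u ^ m / (m.factorial * (m + 1).factorial))
    (fun u hu => tsum_nonneg fun m => by positivity)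
    (fun t ht => Integrable.of_integral_ne_zero (by
      rw [integral_bessel_mul_exp ht]
      exact (sub_pos.2 (Real.one_lt_exp_iff.2 (by positivity))).ne')) k hx
  have hT := laplaceTransform_analyticAt_and_iteratedDeriv
    (φ := fun u : ℝ => u / (1 - Real.exp (-u)))
    (fun u hu => div_nonneg hu.le (sub_nonneg.2 (Real.exp_le_one_iff.2 (by linarith))))
    (fun t ht => Integrable.of_integral_ne_zero (by
      rw [integral_div_one_sub_exp_mul_exp ht]
      exact (trigamma_pos ht).ne')) k hx
  obtain ⟨hB_an, hB_int, hB_deriv⟩ := hB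
  obtain ⟨hT_an, hT_int, hT_deriv⟩ := hT
  have heq : (fun t : ℝ => Real.exp (1 / t) - trigamma t) =ᶠ[𝓝 x] fun t => 1 +
      ((fun t : ℝ => ∫ u in Set.Ioi (0 : ℝ),
        (∑' m : ℕ, u ^ m / (m.factorial * (m + 1).factorial)) * Real.exp (-t * u)) -
      fun t : ℝ => ∫ u in Set.Ioi (0 : ℝ), u / (1 - Real.exp (-u)) * Real.exp (-t * u)) t := by
    filter_upwards [lt_mem_nhds hx] with t ht
    rw [Pi.sub_apply, integral_bessel_mul_exp ht, integral_div_one_sub_exp_mul_exp ht]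
    ring
  rw [heq.iteratedDeriv_eq, iteratedDeriv_const_add hk,
    iteratedDeriv_sub hB_an.contDiffAt hT_an.contDiffAt, hB_deriv, hT_deriv, ← mul_sub,
    ← integral_sub hB_int hT_int, ← mul_assoc, ← mul_pow]
  simp [sub_mul]
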